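/- arXiv:2506.13194 — 2 statements merged into one kernel-verified Lean document; each statement's English description precedes it below -/
import Mathlib

section
/- Product formula for the propagator at three points: for every τ ∈ ℍ and all u, v, w ∈ ℂ with u−w ∉ Λ_τ, w−v ∉ Λ_τ and u−v ∉ Λ_τ, one has P(u−w; τ)·P(w−v; τ) = 2πi · (∂_τ P)(u−v; τ) + (P(w−u; τ) + P(w−v; τ))·P(u−v; τ) + (ζ(w−u; τ) − ζ(w−v; τ))·P′(u−v; τ). -/
open Complex

/-- The lattice `Λ_τ = ℤ + ℤτ ⊆ ℂ`. -/
def latticeSet (τ : ℂ) : Set ℂ := {z | ∃ m n : ℤ, z = (m : ℂ) + (n : ℂ) * τ}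

/-- The Weierstrass `℘`-function `℘(z;τ) = 1/z² + ∑_{ω ∈ Λ_τ∖{0}} (1/(z−ω)² − 1/ω²)`,
with the lattice parametrized by `(m,n) ∈ ℤ × ℤ`. -/
noncomputable def wp (τ z : ℂ) : ℂ :=
  1 / z ^ 2 + ∑' q : ℤ × ℤ, if q = 0 then 0 else
    (1 / (z - ((q.1 : ℂ) + (q.2 : ℂ) * τ)) ^ 2 - 1 / ((q.1 : ℂ) + (q.2 : ℂ) * τ) ^ 2)

/-- The Weierstrass zeta function
`ζ_W(z;τ) = 1/z + ∑_{ω ∈ Λ_τ∖{0}} (1/(z−ω) + 1/ω + z/ω²)`. -/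
noncomputable def wzeta (τ z : ℂ) : ℂ :=
  1 / z + ∑' q : ℤ × ℤ, if q = 0 then 0 else
    (1 / (z - ((q.1 : ℂ) + (q.2 : ℂ) * τ)) + 1 / ((q.1 : ℂ) + (q.2 : ℂ) * τ)
      + z / ((q.1 : ℂ) + (q.2 : ℂ) * τ) ^ 2)

/-- The weight-two Eisenstein series `E₂(τ) = 1 − 24 ∑_{n≥1} σ₁(n) e^{2πinτ}`. -/
noncomputable def eisensteinE2 (τ : ℂ) : ℂ :=
  1 - 24 * ∑' n : ℕ,
    ((ArithmeticFunction.sigma 1 (n + 1) : ℕ) : ℂ) *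
      Complex.exp (2 * Real.pi * Complex.I * ((n : ℂ) + 1) * τ)

/-- The modified Weierstrass function (propagator) `P(z;τ) = ℘(z;τ) + (π²/3)E₂(τ)`. -/
noncomputable def Pfun (τ z : ℂ) : ℂ := wp τ z + ((Real.pi : ℂ) ^ 2 / 3) * eisensteinE2 τ

/-- The modified Weierstrass zeta function `ζ(z;τ) = ζ_W(z;τ) − (π²/3)E₂(τ)·z`. -/
noncomputable def zetafun (τ z : ℂ) : ℂ := wzeta τ z - ((Real.pi : ℂ) ^ 2 / 3) * eisensteinE2 τ * z

section

open EisensteinSeries UpperHalfPlane Filter Topology SummationFilter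

/-- The function `π cot(πz)`. -/
noncomputable def piCot (z : ℂ) : ℂ := Real.pi * Complex.cot (Real.pi * z)

/-- The function `π² / sin²(πz)`. -/
noncomputable def piCscSq (z : ℂ) : ℂ := (Real.pi : ℂ) ^ 2 / Complex.sin (Real.pi * z) ^ 2

lemma piCot_zero : piCot 0 = 0 := by simp [piCot, Complex.cot]

lemma piCot_neg (z : ℂ) : piCot (-z) = -piCot z := by
  simp [piCot, Complex.cot, div_neg]

lemma piCscSq_neg (z : ℂ) : piCscSq (-z) = piCscSq z := by simp [piCscSq]

lemma mem_integerComplement_neg {x : ℂ} (hx : x ∈ Complex.integerComplement) :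
    -x ∈ Complex.integerComplement := by
  rintro ⟨m, hm⟩
  exact hx ⟨-m, by push_cast; rw [hm, neg_neg]⟩

lemma hasDerivAt_piCot {x : ℂ} (hx : x ∈ Complex.integerComplement) :
    HasDerivAt piCot (-piCscSq x) x := by
  have hs := sin_pi_mul_ne_zero hx
  have hl : HasDerivAt (fun z : ℂ => (Real.pi : ℂ) * z) Real.pi x := by
    simpa using (hasDerivAt_id x).const_mul (Real.pi : ℂ)
  have h := ((hl.ccos.div hl.csin hs).const_mul (Real.pi : ℂ))
  refine h.congr_deriv ?_
  have := Complex.sin_sq_add_cos_sq (Real.pi * x)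
  rw [piCscSq]
  field_simp
  linear_combination (-1 : ℂ) * this

lemma hasDerivAt_piCscSq {x : ℂ} (hx : x ∈ Complex.integerComplement) :
    HasDerivAt piCscSq (-2 * piCot x * piCscSq x) x := by
  have hs := sin_pi_mul_ne_zero hx
  have hl : HasDerivAt (fun z : ℂ => (Real.pi : ℂ) * z) Real.pi x := by
    simpa using (hasDerivAt_id x).const_mul (Real.pi : ℂ)
  have h := ((hl.csin.pow 2).fun_inv (pow_ne_zero 2 hs)).const_mul ((Real.pi : ℂ) ^ 2)
  refine h.congr_deriv ?_
  rw [piCscSq, piCot, Complex.cot]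
  simp only [Pi.pow_apply, Nat.cast_ofNat]
  field_simp
  ring

/-- The product formula for `π² / sin²(πz)`. -/
lemma piCscSq_mul {x y : ℂ} (hx : x ∈ Complex.integerComplement) (hy : y ∈ Complex.integerComplement)
    (hxy : x + y ∈ Complex.integerComplement) :
    piCscSq x * piCscSq y = (piCscSq x + piCscSq y) * piCscSq (x + y)
      - (piCot x + piCot y) * (-2 * piCot (x + y) * piCscSq (x + y)) := by
  have hx' := sin_pi_mul_ne_zero hx
  have hy' := sin_pi_mul_ne_zero hy
  have hxy' := sin_pi_mul_ne_zero hxy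
  simp only [piCscSq, piCot, Complex.cot]
  rw [mul_add, Complex.sin_add, Complex.cos_add] at *
  have h1 := Complex.sin_sq_add_cos_sq (Real.pi * x)
  have h2 := Complex.sin_sq_add_cos_sq (Real.pi * y)
  generalize Complex.sin (Real.pi * x) = s at *
  generalize Complex.sin (Real.pi * y) = t at *
  generalize Complex.cos (Real.pi * x) = c at *
  generalize Complex.cos (Real.pi * y) = d at *
  have hne : s * d + t * c ≠ 0 := by rwa [mul_comm t c]
  have key : (s * d + t * c) ^ 2 = t ^ 2 + s ^ 2 + 2 * s * t * (d * c - s * t) := by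
    linear_combination s ^ 2 * h2 + t ^ 2 * h1
  field_simp
  linear_combination (s * d + t * c) * key

lemma summable_inv_add_int_sub_inv (x : ℂ) :
    Summable (fun m : ℤ => 1 / (x + m) - 1 / (m : ℂ)) := by
  have h1 : (fun m : ℤ => (x + m)⁻¹ * (m : ℂ)⁻¹) =O[cofinite] fun m : ℤ => 1 / (m : ℝ) ^ 2 := by
    have ha := linear_inv_isBigO_right 1 x
    have hb := linear_inv_isBigO_right 0 x
    simpa [sq] using ha.mul hb
  have h2 := (summable_of_isBigO (Real.summable_one_div_int_pow.mpr one_lt_two) h1).mul_left (-x)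
  have hfin : ∀ᶠ m : ℤ in cofinite, m ≠ 0 ∧ x + m ≠ 0 := by
    refine (eventually_cofinite_ne 0).and ?_
    have : Set.Subsingleton {m : ℤ | ¬ (x + m ≠ 0)} := by
      intro a ha b hb
      simp only [ne_eq, not_not, Set.mem_ofPred_eq] at ha hb
      exact_mod_cast (add_left_cancel (ha.trans hb.symm) : (a : ℂ) = b)
    exact this.finite
  refine (summable_congr_cofinite ?_).mp h2
  filter_upwards [hfin] with m hm
  have := hm.2
  have : (m : ℂ) ≠ 0 := by exact_mod_cast hm.1
  field_simp
  ring

/-- The Mittag-Leffler expansion of `π cot(πz)` as an absolutely convergent sum over `ℤ`. -/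
lemma hasSum_piCot {x : ℂ} (hx : x ∈ Complex.integerComplement) :
    HasSum (fun m : ℤ => 1 / (x + m) - 1 / (m : ℂ)) (piCot x) := by
  have hs := summable_inv_add_int_sub_inv x
  convert hs.hasSum using 1
  have hp : Summable (fun n : ℕ+ => 1 / (x + ((n : ℤ) : ℂ)) - 1 / ((n : ℤ) : ℂ)) :=
    hs.comp_injective (i := fun n : ℕ+ => (n : ℤ)) fun a b h => by simpa using h
  have hn : Summable (fun n : ℕ+ => 1 / (x + ((-n : ℤ) : ℂ)) - 1 / ((-n : ℤ) : ℂ)) :=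
    hs.comp_injective (i := fun n : ℕ+ => (-n : ℤ)) fun a b h => by simpa using h
  rw [tsum_int_eq_zero_add_tsum_pnat hs, add_assoc, ← hp.tsum_add hn, piCot, cot_series_rep hx]
  simp only [Int.cast_zero, add_zero, div_zero, sub_zero, Int.cast_neg, Int.cast_natCast]
  congr 1
  refine tsum_congr fun n => ?_
  rw [← sub_eq_add_neg x, one_div_neg_eq_neg_one_div]
  ring

lemma hasSum_piCot_zero : HasSum (fun m : ℤ => 1 / ((0 : ℂ) + m) - 1 / (m : ℂ)) (piCot 0) := by
  simp [piCot_zero, hasSum_zero]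

/-- The partial fraction expansion of `π² / sin²(πz)`. -/
lemma hasSum_piCscSq {x : ℂ} (hx : x ∈ Complex.integerComplement) :
    HasSum (fun m : ℤ => 1 / (x + m) ^ 2) (piCscSq x) := by
  obtain ⟨ε, hε, hball⟩ := Metric.isOpen_iff.mp Complex.isOpen_compl_range_intCast x hx
  have hfar (m : ℤ) : ε ≤ ‖x + m‖ := by
    by_contra! h
    refine (hball (a := ((-m : ℤ) : ℂ)) ?_) ⟨-m, rfl⟩
    rw [Metric.mem_ball, dist_comm, dist_eq_norm]
    simpa using h
  have hne (m : ℤ) : x + m ≠ 0 := fun h => by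
    have := hfar m
    rw [h, norm_zero] at this
    linarith
  have hlow (w : ℂ) (hw : w ∈ Metric.ball x (ε / 2)) (m : ℤ) : ‖x + m‖ / 2 ≤ ‖w + m‖ := by
    rw [Metric.mem_ball, dist_comm, dist_eq_norm] at hw
    have h1 := norm_add_le (x - w) (w + m)
    rw [show x - w + (w + m) = x + m by ring] at h1
    linarith [hfar m]
  have hw0 (w : ℂ) (hw : w ∈ Metric.ball x (ε / 2)) (m : ℤ) : w + m ≠ 0 := fun h => by
    have := hlow w hw m
    rw [h, norm_zero] at this
    linarith [hfar m]
  have hsq : Summable fun m : ℤ => ‖((x + m) ^ 2)⁻¹‖ := by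
    simpa using! (linear_right_summable x 1 (k := 2) le_rfl).norm
  have key := Complex.hasSum_deriv_of_summable_norm (U := Metric.ball x (ε / 2))
    (F := fun (m : ℤ) w => 1 / (w + m) - 1 / (x + m)) (z := x) (hsq.mul_left ε) ?_
    Metric.isOpen_ball ?_ (Metric.mem_ball_self (by positivity))
  · have hd (m : ℤ) : deriv (fun w : ℂ => 1 / (w + m) - 1 / (x + m)) x = -(1 / (x + m) ^ 2) := by
      have := ((hasDerivAt_id x).add_const (m : ℂ)).fun_inv (hne m)
      simpa [neg_div] using (this.sub_const (1 / (x + m))).deriv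
    have hsum : (fun w => ∑' m : ℤ, (1 / (w + m) - 1 / (x + m))) =ᶠ[𝓝 x]
        fun w => piCot w - piCot x := by
      filter_upwards [Complex.isOpen_compl_range_intCast.mem_nhds hx] with w hw
      simpa using ((hasSum_piCot hw).sub (hasSum_piCot hx)).tsum_eq
    rw [hsum.deriv_eq, ((hasDerivAt_piCot hx).sub_const _).deriv] at key
    simp only [hd] at key
    simpa using key.neg
  · intro m w hw
    refine DifferentiableAt.differentiableWithinAt ?_
    have := hw0 w hw m
    fun_prop (disch := assumption)
  · intro m w hw
    have h1 := hlow w hw m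
    have hpos : 0 < ‖x + m‖ := norm_pos_iff.mpr (hne m)
    have hw' : ‖x - w‖ ≤ ε / 2 := by
      rw [Metric.mem_ball, dist_comm, dist_eq_norm] at hw
      exact hw.le
    rw [div_sub_div _ _ (hw0 w hw m) (hne m)]
    rw [show 1 * (x + (m : ℂ)) - (w + m) * 1 = x - w by ring, norm_div, norm_mul, norm_inv, norm_pow,
      ← div_eq_mul_inv]
    rw [div_le_div_iff₀ (mul_pos (by linarith) hpos) (by positivity)]
    calc ‖x - w‖ * ‖x + m‖ ^ 2 ≤ ε / 2 * ‖x + m‖ ^ 2 := by gcongr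
      _ = ε * (‖x + m‖ / 2 * ‖x + m‖) := by ring
      _ ≤ _ := by gcongr

lemma hasSum_piCscSq_sub {x : ℂ} (hx : x ∈ Complex.integerComplement) :
    HasSum (fun m : ℤ => 1 / (x - m) ^ 2) (piCscSq x) := by
  have h := hasSum_piCscSq (mem_integerComplement_neg hx)
  rw [piCscSq_neg] at h
  refine h.congr_fun fun m => ?_
  rw [← neg_sub, neg_sq, ← sub_eq_neg_add, ← neg_sub, neg_sq]

lemma hasSum_piCot_sub {x : ℂ} (hx : x ∈ Complex.integerComplement) :
    HasSum (fun m : ℤ => 1 / (x - m) + 1 / (m : ℂ)) (piCot x) := by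
  have h := (hasSum_piCot (mem_integerComplement_neg hx)).neg
  rw [piCot_neg, neg_neg] at h
  refine h.congr_fun fun m => ?_
  rw [← sub_eq_neg_add, ← neg_sub x, one_div_neg_eq_neg_one_div]
  ring

lemma add_mul_mem_integerComplement {τ z : ℂ} (hz : z ∉ latticeSet τ) (n : ℤ) :
    z + n * τ ∈ Complex.integerComplement := by
  rintro ⟨m, hm⟩
  exact hz ⟨m, -n, by push_cast; linear_combination -hm⟩

lemma sub_mul_mem_integerComplement {τ z : ℂ} (hz : z ∉ latticeSet τ) (n : ℤ) :
    z - n * τ ∈ Complex.integerComplement := by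
  simpa [sub_eq_add_neg] using add_mul_mem_integerComplement hz (-n)

lemma notMem_latticeSet_of_forall {τ z : ℂ}
    (h : ∀ n : ℤ, z + n * τ ∈ Complex.integerComplement) : z ∉ latticeSet τ := by
  rintro ⟨m, n, hmn⟩
  exact h (-n) ⟨m, by push_cast; linear_combination -hmn⟩

lemma mul_mem_integerComplement (τ : ℍ) {n : ℤ} (hn : n ≠ 0) :
    (n : ℂ) * τ ∈ Complex.integerComplement := by
  rintro ⟨m, hm⟩
  have := congrArg Complex.im hm
  simp [hn, τ.im_ne_zero] at this

lemma lattice_point_ne_zero (τ : ℍ) {q : ℤ × ℤ} (hq : q ≠ 0) : (q.1 : ℂ) + q.2 * τ ≠ 0 := by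
  intro h
  have h2 : q.2 = 0 := by
    have := congrArg Complex.im h
    simpa [τ.im_ne_zero] using this
  rw [h2] at h
  exact hq (Prod.ext (by simpa using h) h2)

lemma summable_norm_lattice_point_inv_cube (τ : ℍ) :
    Summable (fun q : ℤ × ℤ => (‖(q.1 : ℂ) + q.2 * τ‖ ^ 3)⁻¹) := by
  have h := (Summable.of_nonneg_of_le (fun x => by positivity)
    (summand_bound τ (k := 3) (by norm_num))
    ((summable_one_div_norm_rpow (k := 3) (by norm_num)).mul_left _))
  have h2 := ((Equiv.prodComm ℤ ℤ).trans (finTwoArrowEquiv ℤ).symm).summable_iff.mpr h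
  refine h2.congr fun q => ?_
  simp only [Function.comp_apply, Equiv.trans_apply, Equiv.prodComm_apply, finTwoArrowEquiv_symm_apply,
    Prod.fst_swap, Prod.snd_swap, Matrix.cons_val_zero, Matrix.cons_val_one, Matrix.cons_val_fin_one]
  rw [Real.rpow_neg (norm_nonneg _)]
  norm_cast
  rw [add_comm]

lemma eventually_lt_norm_lattice_point (τ : ℍ) {C : ℝ} (hC : 0 < C) :
    ∀ᶠ q : ℤ × ℤ in cofinite, C < ‖(q.1 : ℂ) + q.2 * τ‖ := by
  have h := (summable_norm_lattice_point_inv_cube τ).tendsto_cofinite_zero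
  filter_upwards [eventually_cofinite_ne (0 : ℤ × ℤ),
    h.eventually_lt_const (show 0 < (C ^ 3)⁻¹ by positivity)] with q hq hlt
  have hpos := norm_pos_iff.mpr (lattice_point_ne_zero τ hq)
  rw [inv_lt_inv₀ (by positivity) (by positivity)] at hlt
  exact lt_of_pow_lt_pow_left₀ 3 hpos.le hlt

lemma summable_wp_summand (τ : ℍ) (z : ℂ) :
    Summable (fun q : ℤ × ℤ => 1 / (z - ((q.1 : ℂ) + q.2 * τ)) ^ 2
      - 1 / ((q.1 : ℂ) + q.2 * τ) ^ 2) := by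
  refine Summable.of_norm_bounded_eventually
    ((summable_norm_lattice_point_inv_cube τ).mul_left (12 * ‖z‖)) ?_
  filter_upwards [eventually_lt_norm_lattice_point τ (C := 2 * ‖z‖ + 1) (by positivity)] with q hq
  generalize (q.1 : ℂ) + q.2 * τ = ω at *
  have hω : 0 < ‖ω‖ := by linarith [norm_nonneg z]
  have h1 : ‖ω‖ / 2 ≤ ‖z - ω‖ := by
    have := norm_sub_norm_le ω z
    rw [norm_sub_rev ω z] at this
    linarith
  have h0 : 0 < ‖z - ω‖ := by linarith
  have h2 : ‖2 * ω - z‖ ≤ 3 * ‖ω‖ := by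
    have := norm_sub_le (2 * ω) z
    rw [norm_mul, Complex.norm_ofNat] at this
    linarith [norm_nonneg z]
  have e : 1 / (z - ω) ^ 2 - 1 / ω ^ 2 = z * (2 * ω - z) / ((z - ω) ^ 2 * ω ^ 2) := by
    have := norm_pos_iff.mp hω
    have := norm_pos_iff.mp h0
    field_simp
    ring
  rw [e, norm_div, norm_mul, norm_mul, norm_pow, norm_pow]
  calc ‖z‖ * ‖2 * ω - z‖ / (‖z - ω‖ ^ 2 * ‖ω‖ ^ 2)
      ≤ ‖z‖ * (3 * ‖ω‖) / ((‖ω‖ / 2) ^ 2 * ‖ω‖ ^ 2) := by gcongr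
    _ = 12 * ‖z‖ * (‖ω‖ ^ 3)⁻¹ := by field_simp; ring

lemma summable_wzeta_summand (τ : ℍ) (z : ℂ) :
    Summable (fun q : ℤ × ℤ => 1 / (z - ((q.1 : ℂ) + q.2 * τ))
      + 1 / ((q.1 : ℂ) + q.2 * τ) + z / ((q.1 : ℂ) + q.2 * τ) ^ 2) := by
  refine Summable.of_norm_bounded_eventually
    ((summable_norm_lattice_point_inv_cube τ).mul_left (2 * ‖z‖ ^ 2)) ?_
  filter_upwards [eventually_lt_norm_lattice_point τ (C := 2 * ‖z‖ + 1) (by positivity)] with q hq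
  generalize (q.1 : ℂ) + q.2 * τ = ω at *
  have hω : 0 < ‖ω‖ := by linarith [norm_nonneg z]
  have h1 : ‖ω‖ / 2 ≤ ‖z - ω‖ := by
    have := norm_sub_norm_le ω z
    rw [norm_sub_rev ω z] at this
    linarith
  have h0 : 0 < ‖z - ω‖ := by linarith
  have e : 1 / (z - ω) + 1 / ω + z / ω ^ 2 = z ^ 2 / ((z - ω) * ω ^ 2) := by
    have := norm_pos_iff.mp hω
    have := norm_pos_iff.mp h0
    field_simp
    ring
  rw [e, norm_div, norm_mul, norm_pow, norm_pow]
  calc ‖z‖ ^ 2 / (‖z - ω‖ * ‖ω‖ ^ 2) ≤ ‖z‖ ^ 2 / (‖ω‖ / 2 * ‖ω‖ ^ 2) := by gcongr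
    _ = 2 * ‖z‖ ^ 2 * (‖ω‖ ^ 3)⁻¹ := by field_simp

lemma hasSum_e2Summand_row (τ : ℍ) (n : ℤ) :
    HasSum (fun m : ℤ => 1 / ((m : ℂ) + n * τ) ^ 2) (e2Summand n τ) := by
  refine (e2Summand_summable n τ).hasSum.congr_fun fun m => ?_
  simp [eisSummand, add_comm]

lemma hasSum_piCot_mul (τ : ℍ) (n : ℤ) :
    HasSum (fun m : ℤ => 1 / ((m : ℂ) + n * τ) - 1 / (m : ℂ)) (piCot (n * τ)) := by
  rcases eq_or_ne n 0 with rfl | hn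
  · simpa using hasSum_piCot_zero
  · simpa [add_comm] using hasSum_piCot (mul_mem_integerComplement τ hn)

/-- Row summation of the Weierstrass `℘`-function. -/
lemma hasSum_wp (τ : ℍ) {z : ℂ} (hz : z ∉ latticeSet τ) :
    HasSum (fun n : ℤ => piCscSq (z - n * τ) - e2Summand n τ) (wp τ z) := by
  have hs := summable_wp_summand τ z
  have h : wp τ z = ∑' q : ℤ × ℤ, (1 / (z - ((q.1 : ℂ) + q.2 * τ)) ^ 2
      - 1 / ((q.1 : ℂ) + q.2 * τ) ^ 2) := by
    rw [hs.tsum_eq_add_tsum_ite 0, wp]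
    simp
  rw [h]
  refine ((Equiv.prodComm ℤ ℤ).hasSum_iff.mpr hs.hasSum).prod_fiberwise fun n => ?_
  refine ((hasSum_piCscSq_sub (sub_mul_mem_integerComplement hz n)).sub
    (hasSum_e2Summand_row τ n)).congr_fun fun m => ?_
  simp only [Function.comp_apply, Equiv.prodComm_apply, Prod.swap_prod_mk]
  ring_nf

/-- Row summation of the Weierstrass zeta function. -/
lemma hasSum_wzeta (τ : ℍ) {z : ℂ} (hz : z ∉ latticeSet τ) :
    HasSum (fun n : ℤ => piCot (z - n * τ) + piCot (n * τ) + z * e2Summand n τ) (wzeta τ z) := by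
  have hs := summable_wzeta_summand τ z
  have h : wzeta τ z = ∑' q : ℤ × ℤ, (1 / (z - ((q.1 : ℂ) + q.2 * τ))
      + 1 / ((q.1 : ℂ) + q.2 * τ) + z / ((q.1 : ℂ) + q.2 * τ) ^ 2) := by
    rw [hs.tsum_eq_add_tsum_ite 0, wzeta]
    simp
  rw [h]
  refine ((Equiv.prodComm ℤ ℤ).hasSum_iff.mpr hs.hasSum).prod_fiberwise fun n => ?_
  refine (((hasSum_piCot_sub (sub_mul_mem_integerComplement hz n)).add
    (hasSum_piCot_mul τ n)).add ((hasSum_e2Summand_row τ n).mul_left z)).congr_fun fun m => ?_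
  simp only [Function.comp_apply, Equiv.prodComm_apply, Prod.swap_prod_mk]
  rw [← sub_sub, sub_right_comm, mul_one_div]
  ring

lemma norm_piCscSq_le {z : ℂ} (hz : 1 ≤ |z.im|) :
    ‖piCscSq z‖ ≤ 16 * Real.pi ^ 2 * Real.exp (-(2 * Real.pi * |z.im|)) := by
  wlog h : 0 ≤ z.im generalizing z
  · simpa [piCscSq_neg] using this (z := -z) (by simpa using hz) (by simp; linarith)
  rw [abs_of_nonneg h] at hz ⊢
  have hy : 1 ≤ Real.pi * z.im := by nlinarith [Real.pi_gt_three]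
  have him : (Real.pi * z).im = Real.pi * z.im := by simp
  have hlow : Real.exp (Real.pi * z.im) / 4 ≤ ‖Complex.sin (Real.pi * z)‖ := by
    rw [Complex.sin, norm_div, norm_mul, Complex.norm_I, mul_one, Complex.norm_ofNat]
    have h1 := norm_sub_norm_le (Complex.exp (-(Real.pi * z) * Complex.I))
      (Complex.exp (Real.pi * z * Complex.I))
    rw [Complex.norm_exp, Complex.norm_exp, Complex.mul_I_re, Complex.mul_I_re, Complex.neg_im, him,
      neg_neg] at h1
    have h2 : Real.exp (-(Real.pi * z.im)) ≤ 1 / 2 := by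
      rw [Real.exp_neg, inv_le_comm₀ (Real.exp_pos _) (by norm_num)]
      linarith [Real.add_one_le_exp (Real.pi * z.im)]
    linarith [Real.add_one_le_exp (Real.pi * z.im)]
  have hpos := Real.exp_pos (Real.pi * z.im)
  rw [piCscSq, norm_div, norm_pow, norm_pow, Complex.norm_real, Real.norm_of_nonneg Real.pi_pos.le]
  calc Real.pi ^ 2 / ‖Complex.sin (Real.pi * z)‖ ^ 2
      ≤ Real.pi ^ 2 / (Real.exp (Real.pi * z.im) / 4) ^ 2 := by gcongr
    _ = _ := by
      rw [Real.exp_neg, show 2 * Real.pi * z.im = Real.pi * z.im + Real.pi * z.im by ring,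
        Real.exp_add]
      field_simp
      norm_num

lemma summable_exp_neg_mul_abs {c : ℝ} (hc : 0 < c) :
    Summable (fun n : ℤ => Real.exp (-(c * |(n : ℝ)|))) := by
  have h : Summable (fun n : ℕ => Real.exp (-(c * n))) := by
    simpa [mul_comm c] using Real.summable_exp_nat_mul_iff.mpr (neg_neg_of_pos hc)
  exact Summable.of_nat_of_neg (by simpa using h) (by simpa using h)

/-- Local domination of the series `∑ₙ π² / sin²(π(z + nτ))` jointly in both variables. -/
lemma exists_summable_bound_piCscSq {z τ : ℂ} (hτ : 0 < τ.im)
    (h : ∀ n : ℤ, z + n * τ ∈ Complex.integerComplement) :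
    ∃ u : ℤ → ℝ, Summable u ∧ ∀ᶠ p : ℂ × ℂ in 𝓝 (z, τ), ∀ n : ℤ,
      p.1 + n * p.2 ∈ Complex.integerComplement ∧ ‖piCscSq (p.1 + n * p.2)‖ ≤ u n := by
  classical
  set δ := τ.im / 2 with hδ
  have hδ0 : 0 < δ := by positivity
  set K := |z.im| + 1 with hK
  set s := Finset.Icc (-⌈(K + 1) / δ⌉) ⌈(K + 1) / δ⌉ with hs
  refine ⟨fun n => 16 * Real.pi ^ 2 * Real.exp (2 * Real.pi * K)
      * Real.exp (-(2 * Real.pi * δ * |(n : ℝ)|))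
      + if n ∈ s then ‖piCscSq (z + n * τ)‖ + 1 else 0, ?_, ?_⟩
  · refine ((summable_exp_neg_mul_abs (by positivity)).mul_left _).add ?_
    exact summable_of_ne_finset_zero (s := s) fun n hn => if_neg hn
  have hfin : ∀ᶠ p : ℂ × ℂ in 𝓝 (z, τ), ∀ n ∈ s,
      p.1 + n * p.2 ∈ Complex.integerComplement ∧
      ‖piCscSq (p.1 + n * p.2)‖ < ‖piCscSq (z + n * τ)‖ + 1 := by
    refine (Filter.eventually_all_finset s).mpr fun n _ => ?_
    have hc : Tendsto (fun p : ℂ × ℂ => p.1 + n * p.2) (𝓝 (z, τ)) (𝓝 (z + n * τ)) :=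
      Continuous.tendsto (by fun_prop) _
    refine (hc.eventually (Complex.isOpen_compl_range_intCast.mem_nhds (h n))).and ?_
    exact ((hasDerivAt_piCscSq (h n)).continuousAt.norm.tendsto.comp hc).eventually_lt_const
      (lt_add_one _)
  have him1 : ∀ᶠ p : ℂ × ℂ in 𝓝 (z, τ), |p.1.im| < K :=
    Tendsto.eventually_lt_const (lt_add_one _)
      (Continuous.tendsto (f := fun p : ℂ × ℂ => |p.1.im|) (by fun_prop) _)
  have him2 : ∀ᶠ p : ℂ × ℂ in 𝓝 (z, τ), δ < p.2.im :=
    Tendsto.eventually_const_lt (half_lt_self hτ)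
      (Continuous.tendsto (f := fun p : ℂ × ℂ => p.2.im) (by fun_prop) _)
  filter_upwards [hfin, him1, him2] with p h1 h2 h3 n
  by_cases hn : n ∈ s
  · refine ⟨(h1 n hn).1, (h1 n hn).2.le.trans ?_⟩
    rw [if_pos hn]
    exact le_add_of_nonneg_left (by positivity)
  · rw [if_neg hn, add_zero]
    have hn' : (K + 1) / δ ≤ |(n : ℝ)| := by
      rw [hs, Finset.mem_Icc, ← abs_le, not_le] at hn
      refine (Int.le_ceil _).trans ?_
      exact_mod_cast hn.le
    rw [div_le_iff₀ hδ0] at hn'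
    have him : |(n : ℝ)| * δ - K ≤ |(p.1 + n * p.2).im| := by
      have e : (p.1 + n * p.2).im = p.1.im + n * p.2.im := by simp
      have h4 := abs_sub_abs_le_abs_sub (n * p.2.im) (-p.1.im)
      rw [abs_neg, sub_neg_eq_add, abs_mul, abs_of_pos (hδ0.trans h3), add_comm] at h4
      rw [e]
      have h5 : |(n : ℝ)| * δ ≤ |(n : ℝ)| * p.2.im := by gcongr
      linarith
    have hone : 1 ≤ |(p.1 + n * p.2).im| := by linarith
    constructor
    · rintro ⟨m, hm⟩
      rw [← hm] at hone
      norm_num at hone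
    · refine (norm_piCscSq_le hone).trans ?_
      rw [mul_assoc (16 * Real.pi ^ 2), ← Real.exp_add]
      gcongr
      nlinarith [mul_le_mul_of_nonneg_left him Real.two_pi_pos.le]

lemma summable_norm_piCscSq {z τ : ℂ} (hτ : 0 < τ.im)
    (h : ∀ n : ℤ, z + n * τ ∈ Complex.integerComplement) :
    Summable (fun n : ℤ => ‖piCscSq (z + n * τ)‖) := by
  obtain ⟨u, hu, hb⟩ := exists_summable_bound_piCscSq hτ h
  exact Summable.of_nonneg_of_le (fun n => norm_nonneg _) (fun n => (hb.self_of_nhds n).2) hu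

lemma eventually_notMem_latticeSet {z τ : ℂ} (hτ : 0 < τ.im) (hz : z ∉ latticeSet τ) :
    ∀ᶠ p : ℂ × ℂ in 𝓝 (z, τ), p.1 ∉ latticeSet p.2 := by
  obtain ⟨u, -, hb⟩ := exists_summable_bound_piCscSq hτ (add_mul_mem_integerComplement hz)
  filter_upwards [hb] with p hp
  exact notMem_latticeSet_of_forall fun n => (hp n).1

lemma hasSum_deriv_piCscSq {A B : ℂ → ℂ} (hA : Differentiable ℂ A) (hB : Differentiable ℂ B)
    {w : ℂ} (hBw : 0 < (B w).im) (hw : A w ∉ latticeSet (B w)) :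
    HasSum (fun n : ℤ => -2 * piCot (A w + n * B w) * piCscSq (A w + n * B w)
        * (deriv A w + n * deriv B w))
      (deriv (fun x => ∑' n : ℤ, piCscSq (A x + n * B x)) w) := by
  obtain ⟨u, hu, hb⟩ := exists_summable_bound_piCscSq hBw (add_mul_mem_integerComplement hw)
  have hc : Tendsto (fun x => (A x, B x)) (𝓝 w) (𝓝 (A w, B w)) :=
    (hA.continuous.prodMk hB.continuous).tendsto w
  obtain ⟨U, hU, hUo, hwU⟩ := _root_.eventually_nhds_iff.mp (hc.eventually hb)
  have hd (n : ℤ) (x : ℂ) (hx : x ∈ U) := (hasDerivAt_piCscSq (hU x hx n).1).comp x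
    ((hA x).hasDerivAt.add ((hB x).hasDerivAt.const_mul (n : ℂ)))
  have := Complex.hasSum_deriv_of_summable_norm (F := fun (n : ℤ) x => piCscSq (A x + n * B x)) hu
    (fun n x hx => (hd n x hx).differentiableAt.differentiableWithinAt) hUo
    (fun n x hx => (hU x hx n).2) hwU
  exact this.congr_fun fun n => ((hd n w hwU).deriv).symm

lemma summable_e2Summand (τ : ℍ) : Summable (e2Summand · τ) := by
  obtain ⟨z, hz⟩ : ∃ z : ℂ, z ∉ latticeSet τ := by
    refine ⟨1 / 2, ?_⟩
    rintro ⟨m, n, h⟩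
    have hn : n = 0 := by
      have := congrArg Complex.im h
      simpa [τ.im_ne_zero] using this
    rw [hn, Int.cast_zero, zero_mul, add_zero, div_eq_iff two_ne_zero] at h
    have : (1 : ℤ) = m * 2 := by exact_mod_cast h
    omega
  have h1 := (summable_norm_piCscSq τ.im_pos (add_mul_mem_integerComplement hz)).of_norm
  have h2 := (Equiv.neg ℤ).summable_iff.mpr h1
  refine (h2.sub (hasSum_wp τ hz).summable).congr fun n => ?_
  simp [sub_eq_add_neg]

lemma hasSum_e2Summand (τ : ℍ) :
    HasSum (e2Summand · τ) ((Real.pi : ℂ) ^ 2 / 3 * eisensteinE2 τ) := by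
  have hs := summable_e2Summand τ
  have h1 := hasSum_e2Summand_symmetricIcc τ
  have h2 : HasSum (e2Summand · τ) (∑' n, e2Summand n τ) (symmetricIcc ℤ) :=
    hs.hasSum.mono_left LeAtTop.le_atTop
  convert hs.hasSum using 1
  rw [h2.unique h1, riemannZeta_two, eisensteinE2,
    tsum_pnat_eq_tsum_succ (f := fun n : ℕ => (ArithmeticFunction.sigma 1 n : ℂ) *
      Complex.exp (2 * Real.pi * Complex.I * τ) ^ n)]
  have (n : ℕ) : Complex.exp (2 * Real.pi * Complex.I * τ) ^ (n + 1) =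
      Complex.exp (2 * Real.pi * Complex.I * ((n : ℂ) + 1) * τ) := by
    rw [← Complex.exp_nat_mul]
    congr 1
    push_cast
    ring
  simp only [this]
  ring

lemma hasSum_Pfun {τ z : ℂ} (hτ : 0 < τ.im) (hz : z ∉ latticeSet τ) :
    HasSum (fun n : ℤ => piCscSq (z + n * τ)) (Pfun τ z) := by
  have h := (hasSum_wp ⟨τ, hτ⟩ hz).add (hasSum_e2Summand ⟨τ, hτ⟩)
  refine ((Equiv.neg ℤ).hasSum_iff.mpr h).congr_fun fun n => ?_
  simp

lemma hasSum_zetafun {τ z : ℂ} (hτ : 0 < τ.im) (hz : z ∉ latticeSet τ) :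
    HasSum (fun n : ℤ => piCot (z + n * τ) - piCot (n * τ)) (zetafun τ z) := by
  have h := (hasSum_wzeta ⟨τ, hτ⟩ hz).sub ((hasSum_e2Summand ⟨τ, hτ⟩).mul_right z)
  refine ((Equiv.neg ℤ).hasSum_iff.mpr h).congr_fun fun n => ?_
  simp [piCot_neg]
  ring

lemma neg_notMem_latticeSet {τ z : ℂ} (hz : z ∉ latticeSet τ) : -z ∉ latticeSet τ := by
  rintro ⟨m, n, h⟩
  exact hz ⟨-m, -n, by push_cast; linear_combination -h⟩

lemma add_int_mul_notMem_latticeSet {τ z : ℂ} (hz : z ∉ latticeSet τ) (N : ℤ) :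
    z + N * τ ∉ latticeSet τ := by
  rintro ⟨m, n, h⟩
  exact hz ⟨m, n - N, by push_cast; linear_combination h⟩

lemma Pfun_neg {τ z : ℂ} (hτ : 0 < τ.im) (hz : z ∉ latticeSet τ) : Pfun τ (-z) = Pfun τ z := by
  refine (hasSum_Pfun hτ (neg_notMem_latticeSet hz)).unique ?_
  refine ((Equiv.neg ℤ).hasSum_iff.mpr (hasSum_Pfun hτ hz)).congr_fun fun n => ?_
  rw [← piCscSq_neg]
  simp [add_comm]

lemma zetafun_neg {τ z : ℂ} (hτ : 0 < τ.im) (hz : z ∉ latticeSet τ) :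
    zetafun τ (-z) = -zetafun τ z := by
  refine (hasSum_zetafun hτ (neg_notMem_latticeSet hz)).unique ?_
  refine ((Equiv.neg ℤ).hasSum_iff.mpr (hasSum_zetafun hτ hz).neg).congr_fun fun n => ?_
  rw [← neg_neg (-z + n * τ), piCot_neg]
  simp [piCot_neg, add_comm]
  ring

lemma hasSum_deriv_Pfun {τ z : ℂ} (hτ : 0 < τ.im) (hz : z ∉ latticeSet τ) :
    HasSum (fun n : ℤ => -2 * piCot (z + n * τ) * piCscSq (z + n * τ)) (deriv (Pfun τ) z) := by
  have h := hasSum_deriv_piCscSq differentiable_id (differentiable_const τ) (w := z) hτ hz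
  have hev : (fun x => ∑' n : ℤ, piCscSq (id x + n * τ)) =ᶠ[𝓝 z] Pfun τ := by
    have hc : Tendsto (fun x => (x, τ)) (𝓝 z) (𝓝 (z, τ)) := Continuous.tendsto (by fun_prop) z
    filter_upwards [hc.eventually (eventually_notMem_latticeSet hτ hz)] with x hx
    exact (hasSum_Pfun hτ hx).tsum_eq
  rw [hev.deriv_eq] at h
  exact h.congr_fun fun n => by simp

lemma hasSum_deriv_Pfun_tau {τ z : ℂ} (hτ : 0 < τ.im) (hz : z ∉ latticeSet τ) :
    HasSum (fun n : ℤ => n * (-2 * piCot (z + n * τ) * piCscSq (z + n * τ)))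
      (deriv (fun s => Pfun s z) τ) := by
  have h := hasSum_deriv_piCscSq (differentiable_const z) differentiable_id (w := τ) hτ hz
  have hev : (fun x => ∑' n : ℤ, piCscSq (z + n * id x)) =ᶠ[𝓝 τ] fun s => Pfun s z := by
    have hc : Tendsto (fun x => (z, x)) (𝓝 τ) (𝓝 (z, τ)) := Continuous.tendsto (by fun_prop) τ
    have him : ∀ᶠ x : ℂ in 𝓝 τ, 0 < x.im :=
      (Complex.continuous_im.tendsto τ).eventually_const_lt hτ
    filter_upwards [hc.eventually (eventually_notMem_latticeSet hτ hz), him] with x hx hx'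
    exact (hasSum_Pfun hx' hx).tsum_eq
  rw [hev.deriv_eq] at h
  exact h.congr_fun fun n => by simp; ring

lemma tendsto_piCot_comap_im_atTop :
    Tendsto piCot (comap Complex.im atTop) (𝓝 (-(Real.pi * Complex.I))) := by
  have h : Tendsto (fun z : ℂ => Complex.exp (2 * Real.pi * Complex.I * z))
      (comap Complex.im atTop) (𝓝 0) := by
    refine Complex.tendsto_exp_comap_re_atBot.comp (tendsto_comap_iff.mpr ?_)
    have : Tendsto (fun z : ℂ => -(2 * Real.pi) * z.im) (comap Complex.im atTop) atBot :=
      tendsto_comap.const_mul_atTop_of_neg (by linarith [Real.pi_pos])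
    refine this.congr fun z => ?_
    simp [mul_comm, mul_left_comm]
  have h2 := ((h.add_const 1).div ((h.const_sub 1).const_mul Complex.I) (by simp)).const_mul
    (Real.pi : ℂ)
  refine (h2.congr fun z => ?_).trans_eq ?_
  · rw [piCot, Complex.cot_pi_eq_exp_ratio]; rfl
  · simp

lemma hasSum_sub_of_tendsto {G : ℤ → ℂ} {L M : ℂ} (hs : Summable fun n : ℤ => G (n + 1) - G n)
    (hL : Tendsto (fun n : ℕ => G n) atTop (𝓝 L)) (hM : Tendsto (fun n : ℕ => G (-n)) atTop (𝓝 M)) :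
    HasSum (fun n : ℤ => G (n + 1) - G n) (L - M) := by
  have h1 : HasSum (fun n : ℕ => G ((n : ℤ) + 1) - G n) (L - G 0) := by
    have hsn : Summable (fun n : ℕ => G ((n : ℤ) + 1) - G n) := hs.comp_injective Nat.cast_injective
    refine hsn.hasSum_iff_tendsto_nat.mpr ((hL.sub_const (G 0)).congr fun n => ?_)
    have := Finset.sum_range_sub (fun k : ℕ => G k) n
    push_cast at this
    exact this.symm
  have h2 : HasSum (fun n : ℕ => G (-((n : ℤ) + 1) + 1) - G (-((n : ℤ) + 1))) (G 0 - M) := by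
    have hinj : Function.Injective (fun n : ℕ => -((n : ℤ) + 1)) := fun a b hab => by simpa using hab
    have hsn : Summable (fun n : ℕ => G (-((n : ℤ) + 1) + 1) - G (-((n : ℤ) + 1))) :=
      hs.comp_injective hinj
    refine hsn.hasSum_iff_tendsto_nat.mpr ((hM.const_sub (G 0)).congr fun n => ?_)
    have := Finset.sum_range_sub' (fun k : ℕ => G (-k)) n
    push_cast at this
    rw [neg_zero] at this
    rw [← this]
    refine Finset.sum_congr rfl fun k _ => ?_
    rw [neg_add_rev, neg_add_cancel_comm]
  have h3 := HasSum.of_nat_of_neg_add_one (f := fun n : ℤ => G (n + 1) - G n) h1 h2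
  rwa [add_comm, sub_add_sub_cancel'] at h3

lemma zetafun_add_tau {τ z : ℂ} (hτ : 0 < τ.im) (hz : z ∉ latticeSet τ) :
    zetafun τ (z + τ) = zetafun τ z - 2 * Real.pi * Complex.I := by
  have hz' : z + τ ∉ latticeSet τ := by simpa using add_int_mul_notMem_latticeSet hz 1
  have h := (hasSum_zetafun hτ hz').sub (hasSum_zetafun hτ hz)
  have h' : HasSum (fun n : ℤ => piCot (z + ((n + 1 : ℤ) : ℂ) * τ) - piCot (z + n * τ))
      (zetafun τ (z + τ) - zetafun τ z) := h.congr_fun fun n => by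
    rw [show z + ((n + 1 : ℤ) : ℂ) * τ = z + τ + n * τ by push_cast; ring]
    ring
  have hlim (w : ℂ) : Tendsto (fun n : ℕ => piCot (w + n * τ)) atTop
      (𝓝 (-(Real.pi * Complex.I))) := by
    refine tendsto_piCot_comap_im_atTop.comp (tendsto_comap_iff.mpr ?_)
    refine (tendsto_atTop_add_const_left _ w.im
      (tendsto_natCast_atTop_atTop.atTop_mul_const hτ)).congr fun n => ?_
    simp
  have := h'.unique (hasSum_sub_of_tendsto (G := fun n : ℤ => piCot (z + n * τ)) h'.summable
    (by simpa using hlim z) (M := Real.pi * Complex.I) ?_)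
  · linear_combination this
  · have h2 := (hlim (-z)).neg
    rw [neg_neg] at h2
    refine h2.congr fun n => ?_
    rw [← piCot_neg]
    congr 1
    push_cast
    ring

lemma zetafun_add_int_mul_tau {τ z : ℂ} (hτ : 0 < τ.im) (hz : z ∉ latticeSet τ) (N : ℤ) :
    zetafun τ (z + N * τ) = zetafun τ z - 2 * Real.pi * Complex.I * N := by
  induction N with
  | zero => simp
  | succ n ih =>
    have h := zetafun_add_tau hτ (add_int_mul_notMem_latticeSet hz n)
    rw [ih] at h
    rw [show z + (((n : ℤ) + 1 : ℤ) : ℂ) * τ = z + (n : ℤ) * τ + τ by push_cast; ring, h]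
    push_cast
    ring
  | pred n ih =>
    have h := zetafun_add_tau hτ (add_int_mul_notMem_latticeSet hz (-n - 1))
    rw [show z + ((-n - 1 : ℤ) : ℂ) * τ + τ = z + (-n : ℤ) * τ by push_cast; ring, ih] at h
    push_cast at h ⊢
    linear_combination -h

lemma hasSum_piCot_add_piCot {τ a b : ℂ} (hτ : 0 < τ.im) (ha : a ∉ latticeSet τ)
    (hb : b ∉ latticeSet τ) :
    HasSum (fun n : ℤ => piCot (a + n * τ) + piCot (b - n * τ)) (zetafun τ a + zetafun τ b) := by
  refine ((hasSum_zetafun hτ ha).add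
    ((Equiv.neg ℤ).hasSum_iff.mpr (hasSum_zetafun hτ hb))).congr_fun fun n => ?_
  simp [piCot_neg, sub_eq_add_neg]
  ring

lemma hasSum_piCscSq_mul_piCscSq_antidiagonal {τ a b : ℂ} (hτ : 0 < τ.im) (ha : a ∉ latticeSet τ)
    (hb : b ∉ latticeSet τ) (hab : a + b ∉ latticeSet τ) (N : ℤ) :
    HasSum (fun n : ℤ => piCscSq (a + n * τ) * piCscSq (b + ((N - n : ℤ) : ℂ) * τ))
      ((Pfun τ a + Pfun τ b) * piCscSq (a + b + N * τ)
        - (zetafun τ a + zetafun τ b) * (-2 * piCot (a + b + N * τ) * piCscSq (a + b + N * τ))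
        + 2 * Real.pi * Complex.I *
          (N * (-2 * piCot (a + b + N * τ) * piCscSq (a + b + N * τ)))) := by
  have h1 := (hasSum_Pfun hτ ha).add ((Equiv.subLeft N).hasSum_iff.mpr (hasSum_Pfun hτ hb))
  have h2 := hasSum_piCot_add_piCot hτ ha (add_int_mul_notMem_latticeSet hb N)
  have h3 := (h1.mul_right (piCscSq (a + b + N * τ))).sub
    (h2.mul_right (-2 * piCot (a + b + N * τ) * piCscSq (a + b + N * τ)))
  rw [zetafun_add_int_mul_tau hτ hb] at h3
  rw [show (Pfun τ a + Pfun τ b) * piCscSq (a + b + N * τ)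
      - (zetafun τ a + zetafun τ b) * (-2 * piCot (a + b + N * τ) * piCscSq (a + b + N * τ))
      + 2 * Real.pi * Complex.I * (N * (-2 * piCot (a + b + N * τ) * piCscSq (a + b + N * τ))) =
      (Pfun τ a + Pfun τ b) * piCscSq (a + b + N * τ)
      - (zetafun τ a + (zetafun τ b - 2 * Real.pi * Complex.I * N))
        * (-2 * piCot (a + b + N * τ) * piCscSq (a + b + N * τ)) by ring]
  refine h3.congr_fun fun n => ?_
  have hs : a + n * τ + (b + ((N - n : ℤ) : ℂ) * τ) = a + b + N * τ := by push_cast; ring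
  have hc : b + N * τ - n * τ = b + ((N - n : ℤ) : ℂ) * τ := by push_cast; ring
  rw [piCscSq_mul (add_mul_mem_integerComplement ha n) (add_mul_mem_integerComplement hb _)
    (by rw [hs]; exact add_mul_mem_integerComplement hab N), hs, hc]
  simp

/-- The equivalence sending `(N, n)` to the pair `(n, N - n)` of sum `N`. -/
def intAntidiagonalEquiv : ℤ × ℤ ≃ ℤ × ℤ where
  toFun q := (q.2, q.1 - q.2)
  invFun q := (q.1 + q.2, q.1)
  left_inv q := by simp
  right_inv q := by simp

/-- The product formula for the modified Weierstrass function, in terms of `a`, `b` and `a + b`. -/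
lemma Pfun_mul_Pfun {τ a b : ℂ} (hτ : 0 < τ.im) (ha : a ∉ latticeSet τ) (hb : b ∉ latticeSet τ)
    (hab : a + b ∉ latticeSet τ) :
    Pfun τ a * Pfun τ b = (Pfun τ a + Pfun τ b) * Pfun τ (a + b)
      - (zetafun τ a + zetafun τ b) * deriv (Pfun τ) (a + b)
      + 2 * Real.pi * Complex.I * deriv (fun s => Pfun s (a + b)) τ := by
  have hprod := (hasSum_Pfun hτ ha).mul (hasSum_Pfun hτ hb) (summable_mul_of_summable_norm
    (f := fun n : ℤ => piCscSq (a + n * τ)) (g := fun n : ℤ => piCscSq (b + n * τ))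
    (summable_norm_piCscSq hτ (add_mul_mem_integerComplement ha))
    (summable_norm_piCscSq hτ (add_mul_mem_integerComplement hb)))
  have hanti : HasSum (fun q : ℤ × ℤ => piCscSq (a + q.2 * τ) *
      piCscSq (b + ((q.1 - q.2 : ℤ) : ℂ) * τ)) (Pfun τ a * Pfun τ b) :=
    (intAntidiagonalEquiv.hasSum_iff.mpr hprod).congr_fun fun q => rfl
  have hsum := hanti.prod_fiberwise
    (hasSum_piCscSq_mul_piCscSq_antidiagonal hτ ha hb hab)
  exact hsum.unique ((((hasSum_Pfun hτ hab).mul_left _).sub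
    ((hasSum_deriv_Pfun hτ hab).mul_left _)).add ((hasSum_deriv_Pfun_tau hτ hab).mul_left _))

end

/-- Product formula for the propagator at three points:
`P(u−w)P(w−v) = 2πi ∂_τ P(u−v) + (P(w−u)+P(w−v))P(u−v) + (ζ(w−u)−ζ(w−v))P′(u−v)`. -/
theorem propagator_product_formula_three_points
    (τ : ℂ) (hτ : 0 < τ.im) (u v w : ℂ)
    (huw : u - w ∉ latticeSet τ) (hwv : w - v ∉ latticeSet τ) (huv : u - v ∉ latticeSet τ) :
    Pfun τ (u - w) * Pfun τ (w - v) =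
      2 * (Real.pi : ℂ) * Complex.I * deriv (fun s => Pfun s (u - v)) τ
        + (Pfun τ (w - u) + Pfun τ (w - v)) * Pfun τ (u - v)
        + (zetafun τ (w - u) - zetafun τ (w - v)) * deriv (Pfun τ) (u - v) := by
  have hab : u - w + (w - v) = u - v := by ring
  have h := Pfun_mul_Pfun hτ huw hwv (by rwa [hab])
  rw [hab] at h
  rw [← neg_sub u w, Pfun_neg hτ huw, zetafun_neg hτ huw, h]
  ring
end

section
/- Product formula for the squared propagator: for every τ ∈ ℍ and every z ∈ ℂ with z ∉ Λ_τ, one has P(z; τ)² = 2πi · (π²/3) · E₂′(τ) + (2π²/3) · E₂(τ) · P(z; τ) + (1/6) · P″(z; τ), where E₂′ denotes the complex derivative of E₂ on ℍ. -/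
open Complex

namespace PeriodPair

open Filter Topology

variable (L : PeriodPair)

/-- The complement of a period lattice is connected. -/
lemma isPreconnected_compl_lattice : IsPreconnected (L.lattice : Set ℂ)ᶜ := by
  have hc : (L.lattice : Set ℂ).Countable := by
    have : Countable L.lattice := L.latticeEquivProd.toEquiv.countable_iff.mpr inferInstance
    exact Set.countable_coe_iff.mp this
  exact (hc.isPathConnected_compl_of_one_lt_rank (by simp)).isConnected.isPreconnected

/-- The derivative of `℘` does not vanish identically. -/
lemma exists_derivWeierstrassP_ne_zero : ∃ z ∉ L.lattice, L.derivWeierstrassP z ≠ 0 := by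
  by_contra! h
  have hcont : Tendsto (fun z ↦ z ^ 3 * L.derivWeierstrassPExcept 0 z) (𝓝[≠] 0) (𝓝 0) := by
    have : ContinuousAt (fun z ↦ z ^ 3 * L.derivWeierstrassPExcept 0 z) 0 :=
      (continuousAt_id.pow 3).mul (L.analyticAt_derivWeierstrassPExcept 0).continuousAt
    simpa using this.tendsto.mono_left nhdsWithin_le_nhds
  have heq : (fun z ↦ z ^ 3 * L.derivWeierstrassPExcept 0 z) =ᶠ[𝓝[≠] 0] fun _ ↦ 2 := by
    filter_upwards [self_mem_nhdsWithin,
      nhdsWithin_le_nhds (L.compl_lattice_sdiff_singleton_mem_nhds 0)] with z hz hz'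
    have hzL : z ∉ L.lattice := fun hmem ↦ hz' ⟨hmem, hz⟩
    have := L.derivWeierstrassPExcept_def 0 z
    rw [h z hzL] at this
    have hz0 : z ≠ 0 := hz
    simp only [ZeroMemClass.coe_zero, sub_zero, zero_add] at this
    rw [this]
    field_simp
  have := tendsto_nhds_unique (hcont.congr' heq) tendsto_const_nhds
  norm_num at this

/-- The second order differential equation `℘″ = 6 ℘² - g₂ / 2`. -/
lemma deriv_derivWeierstrassP (z : ℂ) (hz : z ∉ L.lattice) :
    deriv L.derivWeierstrassP z = 6 * L.weierstrassP z ^ 2 - L.g₂ / 2 := by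
  have hopen : IsOpen (L.lattice : Set ℂ)ᶜ := L.isClosed_lattice.isOpen_compl
  have hmul : ∀ w ∈ (L.lattice : Set ℂ)ᶜ, (L.derivWeierstrassP w *
      (deriv L.derivWeierstrassP w - (6 * L.weierstrassP w ^ 2 - L.g₂ / 2))) = 0 := by
    intro w hw
    have hP : HasDerivAt L.weierstrassP (L.derivWeierstrassP w) w := by
      simpa using ((L.analyticOnNhd_weierstrassP w hw).differentiableAt).hasDerivAt
    have hP' : HasDerivAt L.derivWeierstrassP (deriv L.derivWeierstrassP w) w :=
      (L.analyticOnNhd_derivWeierstrassP w hw).differentiableAt.hasDerivAt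
    have hl := hP'.fun_pow 2
    have hr := (((hP.fun_pow 3).const_mul 4).sub (hP.const_mul L.g₂)).sub_const L.g₃
    have heq := (hl.congr_of_eventuallyEq (f₁ := fun z ↦ 4 * L.weierstrassP z ^ 3 -
      L.g₂ * L.weierstrassP z - L.g₃) (by
        filter_upwards [hopen.mem_nhds hw] with y hy
        exact (L.derivWeierstrassP_sq y hy).symm)).unique hr
    norm_num at heq
    linear_combination heq / 2
  have hc : AnalyticOnNhd ℂ (fun w ↦ deriv L.derivWeierstrassP w -
      (6 * L.weierstrassP w ^ 2 - L.g₂ / 2)) (L.lattice : Set ℂ)ᶜ :=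
    L.analyticOnNhd_derivWeierstrassP.deriv.sub
      ((analyticOnNhd_const.mul (L.analyticOnNhd_weierstrassP.pow 2)).sub analyticOnNhd_const)
  rcases L.analyticOnNhd_derivWeierstrassP.eq_zero_or_eq_zero_of_mul_eq_zero hc hmul
    L.isPreconnected_compl_lattice with h | h
  · obtain ⟨w, hw, hne⟩ := L.exists_derivWeierstrassP_ne_zero
    exact absurd (h w hw) hne
  · exact sub_eq_zero.mp (h z hz)

end PeriodPair

section Ramanujan

open UpperHalfPlane hiding I
open scoped Manifold MatrixGroups ModularForm Topology Derivative
open EisensteinSeries Filter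

namespace EisensteinSeries

/-- The derivative of the error term `D2 γ` in the transformation law of `E₂`. -/
lemma normalizedDerivOfComplex_D2 (γ : SL(2, ℤ)) :
    MDiff (D2 γ) ∧ D (D2 γ) = fun z : ℍ ↦ -((γ 1 0 : ℂ) / denom γ z) ^ 2 := by
  have key (z : ℍ) : HasDerivAt (D2 γ ∘ ofComplex)
      (2 * Real.pi * I * γ 1 0 * (-(γ 1 0 : ℂ) / denom γ z ^ 2)) z := by
    have hd : HasDerivAt (fun w : ℂ ↦ denom γ w) (γ 1 0 : ℂ) z := by
      simpa using hasDerivAt_denom_zpow (γ : GL (Fin 2) ℝ) 1 z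
    refine ((hd.inv (denom_ne_zero γ z)).const_mul (2 * Real.pi * I * γ 1 0)).congr_of_eventuallyEq
      ?_
    filter_upwards [isOpen_upperHalfPlaneSet.mem_nhds z.im_pos] with w hw
    simp [D2, ofComplex_apply_of_im_pos hw, div_eq_mul_inv]
  refine ⟨fun z ↦ mdifferentiableAt_iff.mpr (key z).differentiableAt, ?_⟩
  ext z
  rw [Derivative.normalizedDerivOfComplex, (key z).deriv]
  have := denom_ne_zero γ z
  have hp := Complex.two_pi_I_ne_zero
  field_simp

/-- The function `D E₂ - E₂² / 12`, which is modular of weight `4`. -/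
lemma D_E2_sub_sq_slash (γ : SL(2, ℤ)) :
    (fun z : ℍ ↦ D E2 z - E2 z ^ 2 / 12) ∣[(4 : ℤ)] γ = fun z : ℍ ↦ D E2 z - E2 z ^ 2 / 12 := by
  obtain ⟨hD2, hDD2⟩ := normalizedDerivOfComplex_D2 γ
  have h1 := Derivative.normalizedDerivOfComplex_SL_slash (k := 2) E2_mdifferentiable (γ := γ)
  rw [E2_slash_action, Derivative.normalizedDerivOfComplex_sub _ _ E2_mdifferentiable
    (hD2.const_smul _), Derivative.normalizedDerivOfComplex_smul _ _ hD2, hDD2] at h1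
  ext z
  have h2 := congrFun h1 z
  have h3 := congrFun (ModularForm.mul_slash_SL2 2 2 γ E2 E2) z
  have h4 : (E2 ∣[(2 : ℤ)] γ) z = E2 z - 1 / (2 * riemannZeta 2) * D2 γ z := by
    simp [E2_slash_action]
  have h5 : (fun z : ℍ ↦ D E2 z - E2 z ^ 2 / 12) = D E2 + (-12⁻¹ : ℂ) • (E2 * E2) := by
    ext z; simp; ring
  rw [h5, SlashAction.add_slash, ModularForm.SL_smul_slash]
  simp only [riemannZeta_two, Pi.add_apply, Pi.mul_apply, D2, h4, Pi.sub_apply, Pi.smul_apply, smul_eq_mul,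
    mul_div_assoc (2 * (Real.pi : ℂ) * I)] at h2 h3 ⊢
  norm_num at h2 h3 ⊢
  generalize (γ 1 0 : ℂ) / denom γ z = u at h2 h3
  have hp : (Real.pi : ℂ) ≠ 0 := by exact_mod_cast Real.pi_ne_zero
  rw [h3]
  field_simp at h2 ⊢
  linear_combination -6 * h2 + 36 * u ^ 2 * I_sq

lemma periodic_E2_comp_ofComplex : Function.Periodic (E2 ∘ ofComplex) (1 : ℝ) := by
  intro w
  by_cases! hw : 0 < w.im
  · have hw' : 0 < (w + (1 : ℝ)).im := by simpa using hw
    simp only [Function.comp_apply, ofComplex_apply_of_im_pos hw, ofComplex_apply_of_im_pos hw',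
      E2_eq_tsum_cexp]
    simp [mul_add, Complex.exp_add]
  · have hw' : (w + (1 : ℝ)).im ≤ 0 := by simpa using hw
    simp only [Function.comp_apply, ofComplex_apply_of_im_nonpos hw,
      ofComplex_apply_of_im_nonpos hw']

lemma _root_.UpperHalfPlane.tendsto_atImInfty_cuspFunction {f : ℍ → ℂ}
    (hper : Function.Periodic (f ∘ ofComplex) (1 : ℝ)) (hf : MDiff f)
    (hb : IsBoundedAtImInfty f) : Tendsto f atImInfty (𝓝 (cuspFunction 1 f 0)) := by
  refine ((analyticAt_cuspFunction_zero one_pos hper hf hb).continuousAt.tendsto.comp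
    (qParam_tendsto_atImInfty one_pos)).congr fun τ ↦ ?_
  simpa using eq_cuspFunction τ one_ne_zero hper

/-- The derivative of a periodic function on the upper half-plane vanishes at `i∞`. -/
lemma _root_.UpperHalfPlane.tendsto_normalizedDerivOfComplex_atImInfty {f : ℍ → ℂ}
    (hper : Function.Periodic (f ∘ ofComplex) (1 : ℝ)) (hf : MDiff f)
    (hb : IsBoundedAtImInfty f) : Tendsto (D f) atImInfty (𝓝 0) := by
  set g := cuspFunction 1 f
  have hg : AnalyticAt ℂ g 0 := analyticAt_cuspFunction_zero one_pos hper hf hb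
  have hlim : Tendsto (fun q ↦ q * deriv g q) (𝓝 0) (𝓝 0) := by
    simpa using tendsto_id.mul hg.deriv.continuousAt.tendsto
  refine (hlim.comp (qParam_tendsto_atImInfty one_pos)).congr fun τ ↦ ?_
  have hq : ‖Function.Periodic.qParam 1 (τ : ℂ)‖ < 1 :=
    Function.Periodic.norm_qParam_lt_one one_pos τ.im_pos
  have hgd := (differentiableAt_cuspFunction one_pos hper hf hb hq).hasDerivAt
  have hqd : HasDerivAt (fun w : ℂ ↦ Function.Periodic.qParam 1 w)
      (2 * Real.pi * I * Function.Periodic.qParam 1 (τ : ℂ)) τ := by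
    have := (((hasDerivAt_id (τ : ℂ)).const_mul (2 * Real.pi * I)).div_const ((1 : ℝ) : ℂ)).cexp
    simpa [Function.Periodic.qParam, mul_comm] using this
  have hfd : HasDerivAt (f ∘ ofComplex) _ (τ : ℂ) := (hgd.comp (τ : ℂ) hqd).congr_of_eventuallyEq
    (by
      filter_upwards [isOpen_upperHalfPlaneSet.mem_nhds τ.im_pos] with w hw
      have := eq_cuspFunction ⟨w, hw⟩ one_ne_zero hper
      simp only [Function.comp_apply, ofComplex_apply_of_im_pos hw]
      exact this.symm)
  rw [Derivative.normalizedDerivOfComplex, hfd.deriv]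
  have hp := Complex.two_pi_I_ne_zero
  simp only [Function.comp_apply]
  field_simp
  rfl

lemma cuspFunction_E2_zero : cuspFunction 1 E2 0 = 1 := by
  have h := hasFPowerSeriesOnBall_cuspFunction one_pos (analyticAt_cuspFunction_zero one_pos
    periodic_E2_comp_ofComplex E2_mdifferentiable isBoundedAtImInfty_E2)
    (fun τ ↦ by
      simpa only [Function.Periodic.qParam, ofReal_one, div_one]
        using hasSum_qExpansion_E2 (z := τ))
  simpa using (h.coeff_zero 0).symm

lemma tendsto_E4_atImInfty : Tendsto ModularForm.E₄ atImInfty (𝓝 1) := by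
  have h1 := one_mem_strictPeriods_SL
  have hper := SlashInvariantFormClass.periodic_comp_ofComplex ModularForm.E₄ h1
  have : Fact (IsCusp OnePoint.infty 𝒮ℒ) := ⟨Subgroup.isCusp_of_mem_strictPeriods one_pos h1⟩
  have h : cuspFunction 1 ModularForm.E₄ 0 = 1 := by
    simpa [qExpansion_coeff] using E_qExpansion_coeff_zero (by norm_num : 3 ≤ 4) ⟨2, rfl⟩
  rw [← h]
  exact tendsto_atImInfty_cuspFunction hper ModularForm.E₄.holo'
    (ModularFormClass.bdd_at_infty ModularForm.E₄)

/-- The cusp form `D E₂ - (E₂² - E₄) / 12` of weight `4`. -/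
noncomputable def ramanujanDefect : CuspForm 𝒮ℒ 4 :=
  have hslash (γ : SL(2, ℤ)) :
      ((fun z : ℍ ↦ D E2 z - E2 z ^ 2 / 12) + (12⁻¹ : ℂ) • ⇑ModularForm.E₄) ∣[(4 : ℤ)] γ =
        (fun z : ℍ ↦ D E2 z - E2 z ^ 2 / 12) + (12⁻¹ : ℂ) • ⇑ModularForm.E₄ := by
    rw [SlashAction.add_slash, ModularForm.SL_smul_slash, D_E2_sub_sq_slash]
    congr 2
    exact ModularForm.E₄.slash_action_eq' _ ⟨γ, rfl⟩
  { toFun := (fun z : ℍ ↦ D E2 z - E2 z ^ 2 / 12) + (12⁻¹ : ℂ) • ⇑ModularForm.E₄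
    slash_action_eq' := fun _ ⟨γ, hγ⟩ ↦ hγ ▸ hslash γ
    holo' := by
      have h1 := Derivative.normalizedDerivOfComplex_mdifferentiable E2_mdifferentiable
      have h2 := (E2_mdifferentiable.mul E2_mdifferentiable).const_smul (12⁻¹ : ℂ)
      have h3 := ModularForm.E₄.holo'.const_smul (12⁻¹ : ℂ)
      convert! (h1.sub h2).add h3 using 1
      ext z
      simp
      ring
    zero_at_cusps' {c} hc := by
      rw [Subgroup.IsArithmetic.isCusp_iff_isCusp_SL2Z] at hc
      rw [OnePoint.isZeroAt_iff_forall_SL2Z hc]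
      intro γ _
      rw [hslash γ]
      have hD := tendsto_normalizedDerivOfComplex_atImInfty periodic_E2_comp_ofComplex
        E2_mdifferentiable isBoundedAtImInfty_E2
      have hE := tendsto_atImInfty_cuspFunction periodic_E2_comp_ofComplex
        E2_mdifferentiable isBoundedAtImInfty_E2
      rw [cuspFunction_E2_zero] at hE
      have := (hD.sub ((hE.pow 2).div_const 12)).add (tendsto_E4_atImInfty.const_smul (12⁻¹ : ℂ))
      norm_num at this
      refine this.congr fun z ↦ ?_
      simp }

/-- Ramanujan's identity for the derivative of `E₂`. -/
theorem D_E2_eq (z : ℍ) : D E2 z = (E2 z ^ 2 - ModularForm.E₄ z) / 12 := by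
  have h : ramanujanDefect = 0 := rank_zero_iff_forall_zero.mp
    (CuspForm.rank_eq_zero_of_weight_lt_twelve (by norm_num)) _
  have hz : D E2 z - E2 z ^ 2 / 12 + 12⁻¹ * ModularForm.E₄ z = 0 := congrArg (· z) h
  linear_combination hz

end EisensteinSeries

end Ramanujan

section PropagatorLattice

open UpperHalfPlane hiding I
open scoped Topology Derivative

/-- The period pair `(1, τ)`. -/
noncomputable def UpperHalfPlane.periodPair (τ : ℍ) : PeriodPair where
  ω₁ := 1
  ω₂ := τ
  indep := by
    rw [LinearIndependent.pair_iff]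
    intro s t h
    have him := congrArg Complex.im h
    have ht : t = 0 := by simpa [τ.im_ne_zero] using him
    exact ⟨by simpa [ht] using h, ht⟩

namespace UpperHalfPlane

variable (τ : ℍ)

lemma latticeEquivProd_periodPair_symm (q : ℤ × ℤ) :
    (τ.periodPair.latticeEquivProd.symm q : ℂ) = q.1 + q.2 * τ := by
  rw [PeriodPair.latticeEquiv_symm_apply]
  simp [periodPair]

lemma mem_lattice_periodPair (z : ℂ) : z ∈ τ.periodPair.lattice ↔ z ∈ latticeSet τ := by
  simp [PeriodPair.mem_lattice, latticeSet, periodPair, eq_comm]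

lemma wp_eq_weierstrassP : wp τ = τ.periodPair.weierstrassP := by
  ext z
  rw [← τ.periodPair.weierstrassPExcept_add 0, wp, add_comm, PeriodPair.weierstrassPExcept,
    ← τ.periodPair.latticeEquivProd.symm.toEquiv.tsum_eq]
  congr 1
  · refine tsum_congr fun q ↦ ?_
    simp [-one_div, ← latticeEquivProd_periodPair_symm]
  · simp

lemma g₂_periodPair : τ.periodPair.g₂ = 4 * Real.pi ^ 4 / 3 * ModularForm.E₄ τ := by
  have h := tsum_eisSummand_eq_riemannZeta_mul_eisensteinSeries
    (by norm_num : 3 ≤ 4) τ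
  have hE : ModularForm.E₄ τ =
      1 / 2 * eisensteinSeries (N := 1) 0 4 τ := rfl
  have hG : τ.periodPair.G 4 = ∑' v : Fin 2 → ℤ, EisensteinSeries.eisSummand 4 v τ := by
    rw [PeriodPair.G, ← τ.periodPair.latticeEquivProd.symm.toEquiv.tsum_eq,
      ← ((finTwoArrowEquiv ℤ).trans (Equiv.prodComm ℤ ℤ)).tsum_eq]
    refine tsum_congr fun v ↦ ?_
    simp [latticeEquivProd_periodPair_symm, EisensteinSeries.eisSummand, add_comm]
  rw [PeriodPair.g₂, hG, hE]
  push_cast at h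
  rw [h, riemannZeta_four]
  ring

lemma eisensteinE2_coe : eisensteinE2 τ = EisensteinSeries.E2 τ := by
  rw [EisensteinSeries.E2_eq_tsum_cexp, eisensteinE2,
    tsum_pnat_eq_tsum_succ (f := fun n ↦ (ArithmeticFunction.sigma 1 n : ℂ) *
      cexp (2 * Real.pi * Complex.I * τ) ^ n)]
  congr 3
  ext n
  rw [← Complex.exp_nat_mul]
  push_cast
  ring_nf

lemma deriv_eisensteinE2_coe : deriv eisensteinE2 τ =
    2 * Real.pi * Complex.I * ((eisensteinE2 τ ^ 2 - ModularForm.E₄ τ) / 12) := by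
  have h : eisensteinE2 =ᶠ[𝓝 (τ : ℂ)] EisensteinSeries.E2 ∘ ofComplex := by
    filter_upwards [isOpen_upperHalfPlaneSet.mem_nhds τ.im_pos] with w hw
    simpa [ofComplex_apply_of_im_pos hw] using eisensteinE2_coe ⟨w, hw⟩
  have hp := Complex.two_pi_I_ne_zero
  rw [h.deriv_eq, eisensteinE2_coe, ← EisensteinSeries.D_E2_eq,
    Derivative.normalizedDerivOfComplex]
  field_simp

lemma deriv_deriv_Pfun (z : ℂ) (hz : z ∉ latticeSet τ) :
    deriv (deriv (Pfun τ)) z = 6 * wp τ z ^ 2 - 2 * Real.pi ^ 4 / 3 * ModularForm.E₄ τ := by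
  have h : deriv (Pfun τ) = τ.periodPair.derivWeierstrassP := by
    ext w
    rw [← PeriodPair.deriv_weierstrassP, ← wp_eq_weierstrassP]
    exact deriv_add_const _
  rw [h, PeriodPair.deriv_derivWeierstrassP _ _ (by rwa [mem_lattice_periodPair]),
    wp_eq_weierstrassP, g₂_periodPair]
  ring

end UpperHalfPlane

end PropagatorLattice

/-- Product formula for the squared propagator:
`P(z;τ)² = 2πi (π²/3) E₂′(τ) + (2π²/3) E₂(τ) P(z;τ) + (1/6) P″(z;τ)`. -/
theorem propagator_square_formula
    (τ : ℂ) (hτ : 0 < τ.im) (z : ℂ) (hz : z ∉ latticeSet τ) :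
    Pfun τ z ^ 2 =
      2 * (Real.pi : ℂ) * Complex.I * ((Real.pi : ℂ) ^ 2 / 3) * deriv eisensteinE2 τ
        + (2 * (Real.pi : ℂ) ^ 2 / 3) * eisensteinE2 τ * Pfun τ z
        + (1 / 6) * deriv (deriv (Pfun τ)) z := by
  lift τ to UpperHalfPlane using hτ
  rw [τ.deriv_deriv_Pfun z hz, τ.deriv_eisensteinE2_coe, Pfun]
  linear_combination (-(Real.pi : ℂ) ^ 4 / 9 *
    (eisensteinE2 τ ^ 2 - ModularForm.E₄ τ)) * Complex.I_sq
end
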